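/- arXiv:0803.0428 — 3 statements merged into one kernel-verified Lean document; each statement's English description precedes it below -/
import Mathlib

section
/- Suppose there exists a function G : ℂ → (E' →L[ℂ] E), analytic on 𝔻, such that H(z) ∘ G(z) = id_{E'} for all z ∈ 𝔻 and ‖G(z)‖ ≤ 1 for all z ∈ 𝔻 (i.e. H has a Schur-class right inverse). Then there exist a complex Hilbert space ℋ and a function W : ℂ → (ℋ →L[ℂ] E'), analytic on 𝔻, such that H(z) ∘ H(w)* − id_{E'} = (1 − z · conj(w)) • (W(z) ∘ W(w)*) for all z, w ∈ 𝔻, where H(w)* and W(w)* denote Hilbert-space adjoints. -/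
open Metric TopologicalSpace

noncomputable section

section Parseval

variable {E : Type*} [NormedAddCommGroup E] [InnerProductSpace ℂ E]

theorem circleAverage_norm_sum_pow_smul_sq (a : ℕ → E) (r : ℝ) (N : ℕ) :
    Real.circleAverage (fun z : ℂ => ‖∑ n ∈ Finset.range N, z ^ n • a n‖ ^ 2) 0 r =
      ∑ n ∈ Finset.range N, r ^ (2 * n) * ‖a n‖ ^ 2 := by
  induction N with
  | zero => simp [Real.circleAverage_const]
  | succ N ih =>
    set P : ℂ → ℂ := fun z =>
      ∑ n ∈ Finset.range N, (r : ℂ) ^ (2 * n) * z ^ (N - n) * inner ℂ (a n) (a N)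
    have hPd : Differentiable ℂ P := by fun_prop
    have hP : Real.circleAverage (fun z => (P z).re) 0 r = 0 := by
      have h := Complex.reCLM.circleAverage_comp_comm (f := P) (c := 0) (R := r)
        hPd.continuous.continuousOn.circleIntegrable'
      rw [hPd.diffContOnCl.circleAverage] at h
      have h0 : P 0 = 0 := Finset.sum_eq_zero fun n hn => by
        rw [zero_pow (Nat.sub_ne_zero_of_lt (Finset.mem_range.1 hn))]; simp
      simpa [h0, Function.comp_def] using h
    have hexp : Set.EqOn (fun z : ℂ => ‖∑ n ∈ Finset.range (N + 1), z ^ n • a n‖ ^ 2)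
        (fun z => ‖∑ n ∈ Finset.range N, z ^ n • a n‖ ^ 2 +
          ((2 : ℝ) • (P z).re + r ^ (2 * N) * ‖a N‖ ^ 2)) (sphere 0 |r|) := by
      intro z hz
      have hz' : ‖z‖ ^ 2 = r ^ 2 := by rw [mem_sphere_zero_iff_norm.1 hz, sq_abs]
      have hinner : inner ℂ (∑ n ∈ Finset.range N, z ^ n • a n) (z ^ N • a N) = P z := by
        rw [sum_inner]
        refine Finset.sum_congr rfl fun n hn => ?_
        rw [inner_smul_left, inner_smul_right, ← mul_assoc]
        congr 1
        rw [← Nat.add_sub_of_le (Finset.mem_range.1 hn).le, pow_add, ← mul_assoc, map_pow,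
          ← mul_pow, Complex.conj_mul', pow_mul, ← Complex.ofReal_pow, hz', Complex.ofReal_pow,
          Nat.add_sub_cancel_left]
      simp only [Finset.sum_range_succ]
      rw [@norm_add_sq ℂ, hinner, norm_smul, norm_pow, mul_pow, ← pow_mul, mul_comm N 2, pow_mul,
        hz', ← pow_mul]
      simp [add_assoc]
    rw [Real.circleAverage_congr_sphere hexp, Real.circleAverage_fun_add,
      Real.circleAverage_fun_add, Real.circleAverage_fun_smul, hP, ih, Real.circleAverage_const,
      Finset.sum_range_succ]
    · simp
    all_goals exact Continuous.continuousOn (by fun_prop) |>.circleIntegrable'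

/-- **Parseval's identity** on a circle for power series with coefficients in an inner product
space. -/
theorem hasSum_circleAverage_norm_sq {a : ℕ → E} {F : ℂ → E} {R r : ℝ}
    (hF : ∀ z ∈ ball (0 : ℂ) R, HasSum (fun n => z ^ n • a n) (F z)) (hr : 0 ≤ r) (hrR : r < R) :
    HasSum (fun n => r ^ (2 * n) * ‖a n‖ ^ 2)
      (Real.circleAverage (fun z => ‖F z‖ ^ 2) 0 r) := by
  have hsum : Summable fun n => r ^ n * ‖a n‖ := by
    obtain ⟨s, hrs, hsR⟩ := exists_between hrR
    have hs : 0 < s := hr.trans_lt hrs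
    obtain ⟨C, hC⟩ := (hF s (by simpa [abs_of_pos hs] using hsR)).summable.tendsto_atTop_zero.norm
      |>.bddAbove_range
    refine .of_nonneg_of_le (fun n => by positivity) (fun n => ?_)
      ((summable_geometric_of_lt_one (by positivity) ((div_lt_one hs).2 hrs)).mul_right C)
    have h := hC ⟨n, rfl⟩
    simp only [norm_smul, norm_pow, Complex.norm_real, Real.norm_eq_abs, abs_of_pos hs] at h
    calc r ^ n * ‖a n‖ = (r / s) ^ n * (s ^ n * ‖a n‖) := by rw [div_pow]; field_simp
      _ ≤ _ := by gcongr
  rw [(hasSum_iff_tendsto_nat_of_nonneg (fun n => by positivity) _)]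
  simp only [← circleAverage_norm_sum_pow_smul_sq]
  unfold Real.circleAverage
  refine Filter.Tendsto.const_smul ?_ _
  refine intervalIntegral.tendsto_integral_filter_of_dominated_convergence
    (fun _ => (∑' n, r ^ n * ‖a n‖) ^ 2) (.of_forall fun N => ?_)
    (.of_forall fun N => .of_forall fun θ _ => ?_) (by simp) (.of_forall fun θ _ => ?_)
  · exact Continuous.aestronglyMeasurable (by fun_prop)
  · rw [norm_pow, norm_norm]
    gcongr
    refine (norm_sum_le _ _).trans ?_
    simp only [norm_smul, norm_pow, norm_circleMap_zero, abs_of_nonneg hr]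
    exact hsum.sum_le_tsum _ fun n _ => by positivity
  · exact ((hF _ (by simpa [abs_of_nonneg hr] using hrR)).tendsto_sum_nat.norm).pow 2

/-- Taylor coefficients at the origin depend only on the values of the power series. -/
theorem coeff_eq_of_hasSum_pow_smul {a b : ℕ → E} {F : ℂ → E} {R : ℝ} (hR : 0 < R)
    (ha : ∀ z ∈ ball (0 : ℂ) R, HasSum (fun n => z ^ n • a n) (F z))
    (hb : ∀ z ∈ ball (0 : ℂ) R, HasSum (fun n => z ^ n • b n) (F z)) : a = b := by
  have h := hasSum_circleAverage_norm_sq (a := a - b) (F := fun _ => 0)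
    (fun z hz => by simpa [smul_sub] using (ha z hz).sub (hb z hz)) (half_pos hR).le
    (half_lt_self hR)
  ext n
  have h0 := (hasSum_zero_iff_of_nonneg (f := fun n => (R / 2) ^ (2 * n) * ‖(a - b) n‖ ^ 2)
    fun n => by positivity).1
    (by simpa only [norm_zero, ne_eq, OfNat.ofNat_ne_zero, not_false_eq_true, zero_pow,
      Real.circleAverage_const] using h)
  have hn := congrFun h0 n
  simpa [hR.ne', sub_eq_zero] using hn

end Parseval

section HardySpace

/-- The Hardy space of the unit disc with values in `E`, whose elements are represented by their
square-summable sequences of Taylor coefficients. -/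
def HardySpace (E : Type*) [NormedAddCommGroup E] : Type _ :=
  lp (fun _ : ℕ => E) 2

namespace HardySpace

variable {E : Type*} [NormedAddCommGroup E]

instance : NormedAddCommGroup (HardySpace E) :=
  inferInstanceAs (NormedAddCommGroup (lp (fun _ : ℕ => E) 2))

instance [CompleteSpace E] : CompleteSpace (HardySpace E) :=
  inferInstanceAs (CompleteSpace (lp (fun _ : ℕ => E) 2))

variable [InnerProductSpace ℂ E]

instance : InnerProductSpace ℂ (HardySpace E) :=
  lp.instInnerProductSpace (𝕜 := ℂ) (G := fun _ : ℕ => E)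

/-- The `n`-th Taylor coefficient. -/
def coeff (E : Type*) [NormedAddCommGroup E] [InnerProductSpace ℂ E] (n : ℕ) :
    HardySpace E →L[ℂ] E :=
  LinearMap.mkContinuous
    { toFun := fun f => f.1 n
      map_add' := fun _ _ => rfl
      map_smul' := fun _ _ => rfl } 1
    fun f => (lp.norm_apply_le_norm two_ne_zero f n).trans_eq (one_mul _).symm

theorem norm_coeff_le (n : ℕ) : ‖coeff E n‖ ≤ 1 :=
  LinearMap.mkContinuous_norm_le _ zero_le_one _

theorem hasSum_norm_coeff_sq (f : HardySpace E) :
    HasSum (fun n => ‖coeff E n f‖ ^ 2) (‖f‖ ^ 2) := by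
  have h := lp.hasSum_norm (E := fun _ : ℕ => E) (p := 2) (by simp) f
  simp only [ENNReal.toReal_ofNat, Real.rpow_ofNat] at h
  exact h

theorem hasSum_inner_coeff (f g : HardySpace E) :
    HasSum (fun n => inner ℂ (coeff E n f) (coeff E n g)) (inner ℂ f g) :=
  lp.hasSum_inner (𝕜 := ℂ) (G := fun _ : ℕ => E) f g

theorem exists_coeff_eq {a : ℕ → E} {C : ℝ} (hC : 0 ≤ C)
    (h : ∀ s : Finset ℕ, ∑ n ∈ s, ‖a n‖ ^ 2 ≤ C ^ 2) :
    ∃ f : HardySpace E, ‖f‖ ≤ C ∧ ∀ n, coeff E n f = a n := by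
  let f : lp (fun _ : ℕ => E) 2 := ⟨a, memℓp_gen' (C := C ^ 2) (by simpa using h)⟩
  exact ⟨f, lp.norm_le_of_forall_sum_le (by simp) hC (by simpa using h), fun _ => rfl⟩

theorem norm_pow_smul_coeff_le (z : ℂ) (n : ℕ) : ‖z ^ n • coeff E n‖ ≤ ‖z‖ ^ n := by
  rw [norm_smul, norm_pow]
  exact mul_le_of_le_one_right (by positivity) (norm_coeff_le n)

/-- Evaluation at a point `z` of the unit disc. -/
def eval (E : Type*) [NormedAddCommGroup E] [InnerProductSpace ℂ E] (z : ℂ) :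
    HardySpace E →L[ℂ] E :=
  ∑' n, z ^ n • coeff E n

variable [CompleteSpace E]

theorem coeff_adjoint_coeff (m n : ℕ) (x : E) :
    coeff E m ((coeff E n).adjoint x) = (Pi.single n x : ℕ → E) m := by
  obtain ⟨g, -, hg⟩ := exists_coeff_eq (a := Pi.single n x) (norm_nonneg x) fun s => by
    calc ∑ k ∈ s, ‖(Pi.single n x : ℕ → E) k‖ ^ 2
        = ∑ k ∈ s, if k = n then ‖x‖ ^ 2 else 0 := by
          refine Finset.sum_congr rfl fun k _ => ?_
          split_ifs with h
          · simp [h]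
          · simp [Pi.single_eq_of_ne h]
      _ ≤ ‖x‖ ^ 2 := by
          rw [Finset.sum_ite_eq']
          split_ifs <;> simp
  suffices (coeff E n).adjoint x = g by rw [this, hg]
  refine ext_inner_left ℂ fun f => ?_
  rw [ContinuousLinearMap.adjoint_inner_right]
  refine HasSum.unique ?_ (hasSum_inner_coeff f g)
  convert hasSum_single n fun k hk => ?_ using 1
  · simp [hg]
  · simp [hg, Pi.single_eq_of_ne hk]

theorem hasSum_eval {z : ℂ} (hz : z ∈ ball (0 : ℂ) 1) :
    HasSum (fun n => z ^ n • coeff E n) (eval E z) :=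
  (Summable.of_norm_bounded (summable_geometric_of_lt_one (norm_nonneg z)
    (mem_ball_zero_iff.1 hz)) (norm_pow_smul_coeff_le z)).hasSum

theorem hasSum_eval_apply {z : ℂ} (hz : z ∈ ball (0 : ℂ) 1) (f : HardySpace E) :
    HasSum (fun n => z ^ n • coeff E n f) (eval E z f) :=
  (hasSum_eval hz).mapL (ContinuousLinearMap.apply ℂ E f)

theorem differentiableOn_eval : DifferentiableOn ℂ (eval E) (ball (0 : ℂ) 1) := by
  intro z hz
  obtain ⟨r, hzr, hr⟩ := exists_between (mem_ball_zero_iff.1 hz)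
  have h : DifferentiableOn ℂ (fun w => ∑' n, w ^ n • coeff E n) (ball (0 : ℂ) r) :=
    Complex.differentiableOn_tsum_of_summable_norm
      (summable_geometric_of_lt_one ((norm_nonneg z).trans hzr.le) hr)
      (fun n => by fun_prop) isOpen_ball fun n w hw =>
        (norm_pow_smul_coeff_le w n).trans
          (pow_le_pow_left₀ (norm_nonneg w) (mem_ball_zero_iff.1 hw).le n)
  exact (h.differentiableAt (isOpen_ball.mem_nhds (mem_ball_zero_iff.2 hzr))).differentiableWithinAt

theorem eval_adjoint_coeff {z : ℂ} (hz : z ∈ ball (0 : ℂ) 1) (n : ℕ) (x : E) :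
    eval E z ((coeff E n).adjoint x) = z ^ n • x := by
  refine (hasSum_eval_apply hz _).unique ?_
  convert hasSum_single n fun k hk => ?_ using 1
  · simp [coeff_adjoint_coeff]
  · simp [coeff_adjoint_coeff, Pi.single_eq_of_ne hk]

theorem coeff_adjoint_eval {z : ℂ} (hz : z ∈ ball (0 : ℂ) 1) (x : E) (n : ℕ) :
    coeff E n ((eval E z).adjoint x) = starRingEnd ℂ z ^ n • x := by
  refine ext_inner_left ℂ fun y => ?_
  rw [← ContinuousLinearMap.adjoint_inner_left, ContinuousLinearMap.adjoint_inner_right,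
    eval_adjoint_coeff hz, inner_smul_left, inner_smul_right, map_pow]

/-- The evaluations factor the Szegő kernel. -/
theorem smul_eval_comp_adjoint {z w : ℂ} (hz : z ∈ ball (0 : ℂ) 1)
    (hw : w ∈ ball (0 : ℂ) 1) :
    (1 - z * starRingEnd ℂ w) • (eval E z).comp (eval E w).adjoint =
      ContinuousLinearMap.id ℂ E := by
  ext x
  have hlt : ‖z * starRingEnd ℂ w‖ < 1 := by
    rw [norm_mul, RCLike.norm_conj]
    exact mul_lt_one_of_nonneg_of_lt_one_left (norm_nonneg z) (mem_ball_zero_iff.1 hz)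
      (mem_ball_zero_iff.1 hw).le
  have h := hasSum_eval_apply hz ((eval E w).adjoint x)
  simp only [coeff_adjoint_eval hw, smul_smul, ← mul_pow] at h
  have hne : 1 - z * starRingEnd ℂ w ≠ 0 := sub_ne_zero.2 fun h1 => by simp [← h1] at hlt
  simp [h.unique ((hasSum_geometric_of_norm_lt_one hlt).smul_const x), smul_smul, hne]

variable {E E' : Type*} [NormedAddCommGroup E] [InnerProductSpace ℂ E] [CompleteSpace E]
  [NormedAddCommGroup E'] [InnerProductSpace ℂ E'] [CompleteSpace E']

/-- Multiplication by a Schur function does not increase the Hardy norm of Taylor coefficients. -/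
theorem exists_eval_eq {G : ℂ → E' →L[ℂ] E} (hG : DifferentiableOn ℂ G (ball (0 : ℂ) 1))
    (hG1 : ∀ z ∈ ball (0 : ℂ) 1, ‖G z‖ ≤ 1) (f : HardySpace E') :
    ∃ g : HardySpace E, ‖g‖ ≤ ‖f‖ ∧
      ∀ z ∈ ball (0 : ℂ) 1, eval E z g = G z (eval E' z f) := by
  have hfd : DifferentiableOn ℂ (fun z => eval E' z f) (ball (0 : ℂ) 1) :=
    differentiableOn_eval.clm_apply (differentiableOn_const f)
  have hFd : DifferentiableOn ℂ (fun z => G z (eval E' z f)) (ball (0 : ℂ) 1) :=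
    hG.clm_apply hfd
  obtain ⟨a, ha⟩ : ∃ a : ℕ → E, ∀ z ∈ ball (0 : ℂ) 1,
      HasSum (fun n => z ^ n • a n) (G z (eval E' z f)) := by
    refine ⟨fun n => (n.factorial : ℂ)⁻¹ • iteratedDeriv n (fun z => G z (eval E' z f)) 0,
      fun z hz => ?_⟩
    have h := Complex.hasSum_taylorSeries_on_ball hFd hz
    simp only [sub_zero, smul_comm _ (z ^ _)] at h
    exact h
  have hr : ∀ r ∈ Set.Ioo (0 : ℝ) 1, ∀ s : Finset ℕ,
      ∑ n ∈ s, r ^ (2 * n) * ‖a n‖ ^ 2 ≤ ‖f‖ ^ 2 := by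
    intro r hr s
    have hsph : sphere (0 : ℂ) |r| ⊆ ball 0 1 := by
      rw [abs_of_pos hr.1]; exact sphere_subset_ball hr.2
    have h1 := hasSum_circleAverage_norm_sq ha hr.1.le hr.2
    have h2 := hasSum_circleAverage_norm_sq (fun z hz => hasSum_eval_apply hz f) hr.1.le hr.2
    refine (sum_le_hasSum s (fun n _ => by have := hr.1; positivity) h1).trans (le_trans ?_
      (hasSum_le (fun n => ?_) h2 (hasSum_norm_coeff_sq f)))
    · refine Real.circleAverage_mono
        ((hFd.continuousOn.mono hsph).norm.pow 2).circleIntegrable'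
        ((hfd.continuousOn.mono hsph).norm.pow 2).circleIntegrable' fun z hz => ?_
      gcongr
      exact (G z).le_of_opNorm_le_of_le (hG1 z (hsph hz)) le_rfl |>.trans_eq (one_mul _)
    · exact mul_le_of_le_one_left (by positivity) (pow_le_one₀ hr.1.le hr.2.le)
  have h1 : ∀ s : Finset ℕ, ∑ n ∈ s, ‖a n‖ ^ 2 ≤ ‖f‖ ^ 2 := by
    intro s
    have hc : Continuous fun r : ℝ => ∑ n ∈ s, r ^ (2 * n) * ‖a n‖ ^ 2 := by fun_prop
    have hmem : (1 : ℝ) ∈ closure (Set.Ioo (0 : ℝ) 1) := by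
      rw [closure_Ioo zero_ne_one]; simp
    have hle : (1 : ℝ) ∈ {r : ℝ | ∑ n ∈ s, r ^ (2 * n) * ‖a n‖ ^ 2 ≤ ‖f‖ ^ 2} :=
      closure_minimal (fun r h => hr r h s) (isClosed_le hc continuous_const) hmem
    simpa using hle
  obtain ⟨g, hg, hga⟩ := exists_coeff_eq (norm_nonneg f) h1
  exact ⟨g, hg, fun z hz => (hasSum_eval_apply hz g).unique (by simpa only [hga] using ha z hz)⟩

theorem eval_ext {f g : HardySpace E}
    (h : ∀ z ∈ ball (0 : ℂ) 1, eval E z f = eval E z g) : f = g := by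
  have hfg : (fun n => coeff E n f) = fun n => coeff E n g :=
    coeff_eq_of_hasSum_pow_smul one_pos (fun _ hz => hasSum_eval_apply hz f)
      fun z hz => h z hz ▸ hasSum_eval_apply hz g
  exact lp.ext hfg

/-- Multiplication by a Schur function is a contraction of Hardy spaces. -/
theorem exists_contraction_eval_comp_eq {G : ℂ → E' →L[ℂ] E}
    (hG : DifferentiableOn ℂ G (ball (0 : ℂ) 1)) (hG1 : ∀ z ∈ ball (0 : ℂ) 1, ‖G z‖ ≤ 1) :
    ∃ T : HardySpace E' →L[ℂ] HardySpace E, ‖T‖ ≤ 1 ∧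
      ∀ z ∈ ball (0 : ℂ) 1, (eval E z).comp T = (G z).comp (eval E' z) := by
  choose T hT1 hT using exists_eval_eq hG hG1
  let L : HardySpace E' →ₗ[ℂ] HardySpace E :=
    { toFun := T
      map_add' := fun f g => eval_ext fun z hz => by simp [hT _ z hz]
      map_smul' := fun c f => eval_ext fun z hz => by simp [hT _ z hz] }
  exact ⟨L.mkContinuous 1 fun f => by rw [one_mul]; exact hT1 f,
    L.mkContinuous_norm_le zero_le_one _, fun z hz => ContinuousLinearMap.ext fun f => hT f z hz⟩

end HardySpace

end HardySpace

section DeBrangesRovnyak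

theorem exists_comp_adjoint_eq_id_sub {E F : Type*} [NormedAddCommGroup E]
    [InnerProductSpace ℂ E] [CompleteSpace E] [NormedAddCommGroup F] [InnerProductSpace ℂ F]
    [CompleteSpace F] (T : E →L[ℂ] F) (hT : ‖T‖ ≤ 1) :
    ∃ D : F →L[ℂ] F, D.comp D.adjoint = ContinuousLinearMap.id ℂ F - T.comp T.adjoint := by
  have hpos : 0 ≤ ContinuousLinearMap.id ℂ F - T.comp T.adjoint := by
    rw [ContinuousLinearMap.nonneg_iff_isPositive, ContinuousLinearMap.isPositive_def']
    refine ⟨(IsSelfAdjoint.one _).sub ?_, fun x => ?_⟩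
    · rw [ContinuousLinearMap.isSelfAdjoint_iff', ContinuousLinearMap.adjoint_comp,
        ContinuousLinearMap.adjoint_adjoint]
    · have hx : ‖T.adjoint x‖ ≤ ‖x‖ := by
        refine (T.adjoint.le_of_opNorm_le ?_ x).trans_eq (one_mul _)
        rwa [LinearIsometryEquiv.norm_map]
      rw [ContinuousLinearMap.reApplyInnerSelf_apply, _root_.sub_apply,
        inner_sub_left, map_sub, ContinuousLinearMap.id_apply, ContinuousLinearMap.comp_apply,
        ← ContinuousLinearMap.adjoint_inner_right,
        inner_self_eq_norm_sq, inner_self_eq_norm_sq, sub_nonneg]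
      gcongr
  obtain ⟨D, hD⟩ := CStarAlgebra.nonneg_iff_eq_mul_star_self.1 hpos
  exact ⟨D, hD.symm⟩

/-- The de Branges–Rovnyak kernel of a Schur function admits a Kolmogorov factorization. -/
theorem exists_deBrangesRovnyak_factorization {E E' : Type*} [NormedAddCommGroup E]
    [InnerProductSpace ℂ E] [CompleteSpace E] [NormedAddCommGroup E'] [InnerProductSpace ℂ E']
    [CompleteSpace E'] {G : ℂ → E' →L[ℂ] E} (hG : DifferentiableOn ℂ G (ball (0 : ℂ) 1))
    (hG1 : ∀ z ∈ ball (0 : ℂ) 1, ‖G z‖ ≤ 1) :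
    ∃ V : ℂ → HardySpace E →L[ℂ] E, DifferentiableOn ℂ V (ball (0 : ℂ) 1) ∧
      ∀ z ∈ ball (0 : ℂ) 1, ∀ w ∈ ball (0 : ℂ) 1,
        ContinuousLinearMap.id ℂ E - (G z).comp (G w).adjoint =
          (1 - z * starRingEnd ℂ w) • (V z).comp (V w).adjoint := by
  obtain ⟨T, hT1, hT⟩ := HardySpace.exists_contraction_eval_comp_eq hG hG1
  obtain ⟨D, hD⟩ := exists_comp_adjoint_eq_id_sub T hT1
  refine ⟨fun z => (HardySpace.eval E z).comp D,
    HardySpace.differentiableOn_eval.clm_comp (differentiableOn_const D), fun z hz w hw => ?_⟩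
  have hVV : ((HardySpace.eval E z).comp D).comp ((HardySpace.eval E w).comp D).adjoint =
      (HardySpace.eval E z).comp (HardySpace.eval E w).adjoint -
        (G z).comp
          (((HardySpace.eval E' z).comp (HardySpace.eval E' w).adjoint).comp (G w).adjoint) := by
    calc _ = (HardySpace.eval E z).comp ((D.comp D.adjoint).comp (HardySpace.eval E w).adjoint) := by
          simp only [ContinuousLinearMap.adjoint_comp, ContinuousLinearMap.comp_assoc]
      _ = (HardySpace.eval E z).comp (HardySpace.eval E w).adjoint -
          ((HardySpace.eval E z).comp T).comp ((HardySpace.eval E w).comp T).adjoint := by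
          simp only [hD, ContinuousLinearMap.adjoint_comp, ContinuousLinearMap.comp_assoc,
            ContinuousLinearMap.sub_comp, ContinuousLinearMap.comp_sub,
            ContinuousLinearMap.id_comp]
      _ = _ := by
          simp only [hT z hz, hT w hw, ContinuousLinearMap.adjoint_comp,
            ContinuousLinearMap.comp_assoc]
  rw [hVV, smul_sub, HardySpace.smul_eval_comp_adjoint hz hw, ← ContinuousLinearMap.comp_smul,
    ← ContinuousLinearMap.smul_comp, HardySpace.smul_eval_comp_adjoint hz hw,
    ContinuousLinearMap.id_comp]

end DeBrangesRovnyak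

theorem schur_right_inverse_factorization
    {E E' : Type} [NormedAddCommGroup E] [InnerProductSpace ℂ E] [CompleteSpace E]
    [SeparableSpace E]
    [NormedAddCommGroup E'] [InnerProductSpace ℂ E'] [CompleteSpace E']
    [SeparableSpace E']
    (H : ℂ → (E →L[ℂ] E')) (hHa : AnalyticOnNhd ℂ H (ball (0 : ℂ) 1))
    (hinv : ∃ G : ℂ → (E' →L[ℂ] E), AnalyticOnNhd ℂ G (ball (0 : ℂ) 1) ∧
      ∀ z ∈ ball (0 : ℂ) 1,
        (H z).comp (G z) = ContinuousLinearMap.id ℂ E' ∧ ‖G z‖ ≤ 1) :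
    ∃ (ℋ : Type) (_ : NormedAddCommGroup ℋ) (_ : InnerProductSpace ℂ ℋ)
      (_ : CompleteSpace ℋ) (W : ℂ → (ℋ →L[ℂ] E')),
      AnalyticOnNhd ℂ W (ball (0 : ℂ) 1) ∧
      ∀ z ∈ ball (0 : ℂ) 1, ∀ w ∈ ball (0 : ℂ) 1,
        (H z).comp (ContinuousLinearMap.adjoint (H w)) - ContinuousLinearMap.id ℂ E' =
          (1 - z * (starRingEnd ℂ w)) • ((W z).comp (ContinuousLinearMap.adjoint (W w))) := by
  obtain ⟨G, hGa, hG⟩ := hinv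
  obtain ⟨V, hVd, hV⟩ :=
    exists_deBrangesRovnyak_factorization hGa.differentiableOn fun z hz => (hG z hz).2
  refine ⟨HardySpace E, inferInstance, inferInstance, inferInstance,
    fun z => (H z).comp (V z), (hHa.differentiableOn.clm_comp hVd).analyticOnNhd isOpen_ball,
    fun z hz w hw => ?_⟩
  calc _ = (H z).comp (H w).adjoint - ((H z).comp (G z)).comp ((H w).comp (G w)).adjoint := by
        rw [(hG z hz).1, (hG w hw).1, ContinuousLinearMap.id_comp,
          show (ContinuousLinearMap.id ℂ E').adjoint = ContinuousLinearMap.id ℂ E' from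
            ContinuousLinearMap.adjoint_id]
    _ = (H z).comp ((ContinuousLinearMap.id ℂ E - (G z).comp (G w).adjoint).comp
          (H w).adjoint) := by
        simp only [ContinuousLinearMap.adjoint_comp, ContinuousLinearMap.comp_assoc,
          ContinuousLinearMap.sub_comp, ContinuousLinearMap.comp_sub, ContinuousLinearMap.id_comp]
    _ = _ := by
        simp only [hV z hz w hw, ContinuousLinearMap.adjoint_comp, ContinuousLinearMap.comp_assoc,
          ContinuousLinearMap.smul_comp, ContinuousLinearMap.comp_smul]
end
end

section
/- For all w₁, w₂ ∈ 𝔻 and all e₁, e₂ ∈ E' the following inner-product identity holds: ⟨conj(w₁) • W(w₁)* e₁, conj(w₂) • W(w₂)* e₂⟩_ℋ + ⟨H(w₁)* e₁, H(w₂)* e₂⟩_E = ⟨W(w₁)* e₁, W(w₂)* e₂⟩_ℋ + ⟨e₁, e₂⟩_{E'} (inner products conjugate-linear in the first argument). This expresses that the map V₀ sending (conj(w) • W(w)* e, H(w)* e) to (W(w)* e, e) is a well-defined isometry. -/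
open Metric
open scoped InnerProductSpace

noncomputable section

theorem lurking_isometry_inner_identity
    {E E' ℋ : Type} [NormedAddCommGroup E] [InnerProductSpace ℂ E] [CompleteSpace E]
    [NormedAddCommGroup E'] [InnerProductSpace ℂ E'] [CompleteSpace E']
    [NormedAddCommGroup ℋ] [InnerProductSpace ℂ ℋ] [CompleteSpace ℋ]
    (H : ℂ → (E →L[ℂ] E')) (W : ℂ → (ℋ →L[ℂ] E'))
    (hfac : ∀ z ∈ ball (0 : ℂ) 1, ∀ w ∈ ball (0 : ℂ) 1,
      (H z).comp (ContinuousLinearMap.adjoint (H w)) - ContinuousLinearMap.id ℂ E' =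
        (1 - z * (starRingEnd ℂ w)) • ((W z).comp (ContinuousLinearMap.adjoint (W w)))) :
    ∀ w₁ ∈ ball (0 : ℂ) 1, ∀ w₂ ∈ ball (0 : ℂ) 1, ∀ (e₁ e₂ : E'),
      ⟪(starRingEnd ℂ w₁) • (ContinuousLinearMap.adjoint (W w₁)) e₁,
        (starRingEnd ℂ w₂) • (ContinuousLinearMap.adjoint (W w₂)) e₂⟫_ℂ +
      ⟪(ContinuousLinearMap.adjoint (H w₁)) e₁,
        (ContinuousLinearMap.adjoint (H w₂)) e₂⟫_ℂ =
      ⟪(ContinuousLinearMap.adjoint (W w₁)) e₁,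
        (ContinuousLinearMap.adjoint (W w₂)) e₂⟫_ℂ + ⟪e₁, e₂⟫_ℂ := by
  intro w₁ hw₁ w₂ hw₂ e₁ e₂
  have h := congrArg (fun T : E' →L[ℂ] E' => ⟪e₁, T e₂⟫_ℂ) (hfac w₁ hw₁ w₂ hw₂)
  simp only [sub_apply, smul_apply,
    ContinuousLinearMap.comp_apply, ContinuousLinearMap.id_apply, inner_sub_right,
    inner_smul_right] at h
  simp only [inner_smul_left, inner_smul_right, Complex.conj_conj,
    ContinuousLinearMap.adjoint_inner_left]
  linear_combination h
end
end

section
/- For every z ∈ 𝔻 the operator id_ℋ − z • A* is invertible in the Banach algebra of bounded operators on ℋ, and the operator G(z) := D* + B* ∘ (id_ℋ − z • A*)⁻¹ ∘ (z • C*) : E' →L[ℂ] E satisfies H(z) ∘ G(z) = id_{E'} and ‖G(z)‖ ≤ 1. -/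
open Metric

noncomputable section

/-- The adjoint of a contractive two-by-two block operator is contractive. -/
theorem norm_sq_adjoint_block_le
    {X Y X' Y' : Type*} [NormedAddCommGroup X] [InnerProductSpace ℂ X] [CompleteSpace X]
    [NormedAddCommGroup Y] [InnerProductSpace ℂ Y] [CompleteSpace Y]
    [NormedAddCommGroup X'] [InnerProductSpace ℂ X'] [CompleteSpace X']
    [NormedAddCommGroup Y'] [InnerProductSpace ℂ Y'] [CompleteSpace Y']
    {A : X →L[ℂ] X'} {B : Y →L[ℂ] X'} {C : X →L[ℂ] Y'} {D : Y →L[ℂ] Y'}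
    (hcontr : ∀ (x : X) (y : Y),
      ‖A x + B y‖ ^ 2 + ‖C x + D y‖ ^ 2 ≤ ‖x‖ ^ 2 + ‖y‖ ^ 2) (x : X') (y : Y') :
    ‖A.adjoint x + C.adjoint y‖ ^ 2 + ‖B.adjoint x + D.adjoint y‖ ^ 2 ≤
      ‖x‖ ^ 2 + ‖y‖ ^ 2 := by
  set u := A.adjoint x + C.adjoint y with hu
  set v := B.adjoint x + D.adjoint y with hv
  have key : ‖u‖ ^ 2 + ‖v‖ ^ 2 =
      (inner ℂ (A u + B v) x).re + (inner ℂ (C u + D v) y).re := by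
    have h₁ : ‖u‖ ^ 2 = (inner ℂ u u).re := (inner_self_eq_norm_sq (𝕜 := ℂ) u).symm
    have h₂ : ‖v‖ ^ 2 = (inner ℂ v v).re := (inner_self_eq_norm_sq (𝕜 := ℂ) v).symm
    have h₃ : inner ℂ u u = inner ℂ (A u) x + inner ℂ (C u) y := by
      conv_lhs => rw [hu, inner_add_right, ← hu]
      simp only [ContinuousLinearMap.adjoint_inner_right]
    have h₄ : inner ℂ v v = inner ℂ (B v) x + inner ℂ (D v) y := by
      conv_lhs => rw [hv, inner_add_right, ← hv]
      simp only [ContinuousLinearMap.adjoint_inner_right]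
    rw [h₁, h₂, h₃, h₄, inner_add_left, inner_add_left]
    simp only [Complex.add_re]
    ring
  have hx : (inner ℂ (A u + B v) x).re ≤ ‖A u + B v‖ * ‖x‖ :=
    re_inner_le_norm (𝕜 := ℂ) _ _
  have hy : (inner ℂ (C u + D v) y).re ≤ ‖C u + D v‖ * ‖y‖ :=
    re_inner_le_norm (𝕜 := ℂ) _ _
  nlinarith [hcontr u v, sq_nonneg (‖A u + B v‖ - ‖x‖), sq_nonneg (‖C u + D v‖ - ‖y‖)]

theorem characteristic_function_is_schur_right_inverse
    {ℋ E E' : Type} [NormedAddCommGroup ℋ] [InnerProductSpace ℂ ℋ] [CompleteSpace ℋ]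
    [NormedAddCommGroup E] [InnerProductSpace ℂ E] [CompleteSpace E]
    [NormedAddCommGroup E'] [InnerProductSpace ℂ E'] [CompleteSpace E']
    (H : ℂ → (E →L[ℂ] E')) (W : ℂ → (ℋ →L[ℂ] E'))
    (A : ℋ →L[ℂ] ℋ) (B : E →L[ℂ] ℋ) (C : ℋ →L[ℂ] E') (D : E →L[ℂ] E')
    (hcontr : ∀ (h : ℋ) (e : E),
      ‖A h + B e‖ ^ 2 + ‖C h + D e‖ ^ 2 ≤ ‖h‖ ^ 2 + ‖e‖ ^ 2)
    (hAB : ∀ w ∈ ball (0 : ℂ) 1,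
      (starRingEnd ℂ w) • (A.comp (ContinuousLinearMap.adjoint (W w))) +
        B.comp (ContinuousLinearMap.adjoint (H w)) = ContinuousLinearMap.adjoint (W w))
    (hCD : ∀ w ∈ ball (0 : ℂ) 1,
      (starRingEnd ℂ w) • (C.comp (ContinuousLinearMap.adjoint (W w))) +
        D.comp (ContinuousLinearMap.adjoint (H w)) = ContinuousLinearMap.id ℂ E') :
    ∀ z ∈ ball (0 : ℂ) 1,
      IsUnit (1 - z • ContinuousLinearMap.adjoint A) ∧
      (H z).comp (ContinuousLinearMap.adjoint D +
        (ContinuousLinearMap.adjoint B).comp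
          ((Ring.inverse (1 - z • ContinuousLinearMap.adjoint A)).comp
            (z • ContinuousLinearMap.adjoint C))) = ContinuousLinearMap.id ℂ E' ∧
      ‖ContinuousLinearMap.adjoint D +
        (ContinuousLinearMap.adjoint B).comp
          ((Ring.inverse (1 - z • ContinuousLinearMap.adjoint A)).comp
            (z • ContinuousLinearMap.adjoint C))‖ ≤ 1 := by
  intro z hz
  have hz₁ : ‖z‖ < 1 := by simpa using hz
  have hA : ‖A‖ ≤ 1 := A.opNorm_le_bound zero_le_one fun h => by
    have := hcontr h 0
    simp only [map_zero, add_zero, norm_zero] at this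
    rw [one_mul]
    exact abs_le_of_sq_le_sq' (by nlinarith [sq_nonneg ‖C h‖]) (norm_nonneg h) |>.2
  have hunit : IsUnit (1 - z • ContinuousLinearMap.adjoint A) := by
    refine isUnit_one_sub_of_norm_lt_one ?_
    rw [norm_smul, LinearIsometryEquiv.norm_map]
    nlinarith [norm_nonneg z, norm_nonneg A]
  have hR : ∀ x : ℋ, (1 - z • ContinuousLinearMap.adjoint A)
      (Ring.inverse (1 - z • ContinuousLinearMap.adjoint A) x) = x := fun x => by
    simpa using DFunLike.congr_fun (Ring.mul_inverse_cancel _ hunit) x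
  refine ⟨hunit, ?_, ?_⟩
  · ext y
    have hB (x : ℋ) : H z (B.adjoint x) = W z ((1 - z • A.adjoint) x) := by
      have := DFunLike.congr_fun (congrArg ContinuousLinearMap.adjoint (hAB z hz)) x
      simp only [map_add, map_smulₛₗ, ContinuousLinearMap.adjoint_comp,
        ContinuousLinearMap.adjoint_adjoint, add_apply,
        smul_apply, ContinuousLinearMap.comp_apply,
        RingHomCompTriple.comp_apply, RingHom.id_apply] at this
      simp [← this]
    have hD := DFunLike.congr_fun (congrArg ContinuousLinearMap.adjoint (hCD z hz)) y
    simp only [map_add, map_smulₛₗ, ContinuousLinearMap.adjoint_comp,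
      ContinuousLinearMap.adjoint_adjoint, add_apply,
      smul_apply, ContinuousLinearMap.comp_apply,
      RingHomCompTriple.comp_apply, RingHom.id_apply, ContinuousLinearMap.adjoint_id,
      ContinuousLinearMap.id_apply] at hD
    rw [ContinuousLinearMap.comp_apply, add_apply, map_add,
      ContinuousLinearMap.comp_apply, hB, ContinuousLinearMap.comp_apply, hR,
      smul_apply, map_smul, add_comm]
    exact hD
  · refine ContinuousLinearMap.opNorm_le_bound _ zero_le_one fun y => ?_
    rw [one_mul, add_apply, ContinuousLinearMap.comp_apply,
      ContinuousLinearMap.comp_apply]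
    have hx := hR ((z • C.adjoint) y)
    set x := Ring.inverse (1 - z • A.adjoint) ((z • C.adjoint) y)
    have hfix : x = z • (A.adjoint x + C.adjoint y) := by
      simp only [sub_apply, one_apply_eq_self, smul_apply] at hx
      rw [smul_add, ← hx]
      abel
    have hle : ‖x‖ ≤ ‖A.adjoint x + C.adjoint y‖ := by
      conv_lhs => rw [hfix, norm_smul]
      exact mul_le_of_le_one_left (norm_nonneg _) hz₁.le
    have hblock := norm_sq_adjoint_block_le hcontr x y
    rw [add_comm (D.adjoint y)]
    exact abs_le_of_sq_le_sq' (by nlinarith [norm_nonneg x]) (norm_nonneg y) |>.2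
end
end
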